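/- Let A₁, A₂, A₃ ∈ SL(2,ℂ) have all seven traces tr ρ(w) (w ∈ {a₁,a₂,a₃,a₁a₂,a₁a₃,a₂a₃,a₁a₂a₃}) real, and suppose (A₁,A₂,A₃) is elementwise-periodic. If one of the seven matrices W ∈ {A₁, A₂, A₃, A₁A₂, A₁A₃, A₂A₃, A₁A₂A₃} satisfies tr W = 2 or tr W = −2 but W ≠ I and W ≠ −I (i.e. W is, up to sign, a nonidentity parabolic), then there exists t ∈ ℝ³ with χ(id) = Π₃(t). -/

import Mathlib

open Matrix Real

noncomputable section

abbrev SL2C := Matrix.SpecialLinearGroup (Fin 2) ℂ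

/-- The representation `F₃ → SL(2,ℂ)` sending `aᵢ ↦ Aᵢ`. -/
def rho (A₁ A₂ A₃ : SL2C) : FreeGroup (Fin 3) →* SL2C := FreeGroup.lift ![A₁, A₂, A₃]

/-- The seven words `a₁, a₂, a₃, a₁a₂, a₁a₃, a₂a₃, a₁a₂a₃`, indexed `0,…,6`. -/
def w : Fin 7 → FreeGroup (Fin 3) :=
  ![FreeGroup.of 0, FreeGroup.of 1, FreeGroup.of 2,
    FreeGroup.of 0 * FreeGroup.of 1, FreeGroup.of 0 * FreeGroup.of 2,
    FreeGroup.of 1 * FreeGroup.of 2, FreeGroup.of 0 * FreeGroup.of 1 * FreeGroup.of 2]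

/-- `χ(α) = (tr ρ(α(w))/2)_w ∈ ℂ⁷`. -/
def chi (A₁ A₂ A₃ : SL2C) (α : MulAut (FreeGroup (Fin 3))) : Fin 7 → ℂ :=
  fun i => Matrix.trace ((rho A₁ A₂ A₃ (α (w i)) : Matrix (Fin 2) (Fin 2) ℂ)) / 2

/-- `(A₁,A₂,A₃)` is elementwise-periodic. -/
def ElemPeriodic (A₁ A₂ A₃ : SL2C) : Prop :=
  ∀ α : MulAut (FreeGroup (Fin 3)), (Set.range fun k : ℕ => chi A₁ A₂ A₃ (α ^ k)).Finite

/-- `Π₃(t₁,t₂,t₃)`. -/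
def Pi3 (t₁ t₂ t₃ : ℝ) : Fin 7 → ℝ :=
  ![Real.cos (2 * π * t₁), Real.cos (2 * π * t₂), Real.cos (2 * π * t₃),
    Real.cos (2 * π * (t₁ + t₂)), Real.cos (2 * π * (t₁ + t₃)),
    Real.cos (2 * π * (t₂ + t₃)), Real.cos (2 * π * (t₁ + t₂ + t₃))]

/-- An automorphism of the free group from images of generators and inverse images. -/
def mkAut (f g : Fin 3 → FreeGroup (Fin 3))
    (h1 : ∀ i, FreeGroup.lift g (f i) = FreeGroup.of i)
    (h2 : ∀ i, FreeGroup.lift f (g i) = FreeGroup.of i) : MulAut (FreeGroup (Fin 3)) :=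
  MonoidHom.toMulEquiv (FreeGroup.lift f) (FreeGroup.lift g)
    (by ext i; simp [h1]) (by ext i; simp [h2])

lemma mkAut_apply (f g h1 h2 x) : mkAut f g h1 h2 x = FreeGroup.lift f x := rfl

def FTrans (u b : FreeGroup (Fin 3)) : Prop :=
  ∃ α : MulAut (FreeGroup (Fin 3)), α u = u ∧ α b = u * b

local notation "x₁" => (FreeGroup.of (0 : Fin 3))
local notation "x₂" => (FreeGroup.of (1 : Fin 3))
local notation "x₃" => (FreeGroup.of (2 : Fin 3))

lemma ftrans_of (u b : FreeGroup (Fin 3)) (f g : Fin 3 → FreeGroup (Fin 3))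
    (h1 : ∀ i, FreeGroup.lift g (f i) = FreeGroup.of i)
    (h2 : ∀ i, FreeGroup.lift f (g i) = FreeGroup.of i)
    (h3 : FreeGroup.lift f u = u) (h4 : FreeGroup.lift f b = u * b) : FTrans u b :=
  ⟨mkAut f g h1 h2, h3, h4⟩

lemma ftrans_1_2 : FTrans (x₁) x₂ := by
  refine ftrans_of _ _ ![x₁, (x₁) * x₂, x₃]
    ![x₁, (x₁)⁻¹ * x₂, x₃] ?_ ?_ ?_ ?_
  · intro i; fin_cases i <;> simp <;> group
  · intro i; fin_cases i <;> simp <;> group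
  · simp <;> group
  · simp <;> group

lemma ftrans_1_3 : FTrans (x₁) x₃ := by
  refine ftrans_of _ _ ![x₁, x₂, (x₁) * x₃]
    ![x₁, x₂, (x₁)⁻¹ * x₃] ?_ ?_ ?_ ?_
  · intro i; fin_cases i <;> simp <;> group
  · intro i; fin_cases i <;> simp <;> group
  · simp <;> group
  · simp <;> group

lemma ftrans_2_1 : FTrans (x₂) x₁ := by
  refine ftrans_of _ _ ![(x₂) * x₁, x₂, x₃]
    ![(x₂)⁻¹ * x₁, x₂, x₃] ?_ ?_ ?_ ?_
  · intro i; fin_cases i <;> simp <;> group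
  · intro i; fin_cases i <;> simp <;> group
  · simp <;> group
  · simp <;> group

lemma ftrans_2_3 : FTrans (x₂) x₃ := by
  refine ftrans_of _ _ ![x₁, x₂, (x₂) * x₃]
    ![x₁, x₂, (x₂)⁻¹ * x₃] ?_ ?_ ?_ ?_
  · intro i; fin_cases i <;> simp <;> group
  · intro i; fin_cases i <;> simp <;> group
  · simp <;> group
  · simp <;> group

lemma ftrans_3_1 : FTrans (x₃) x₁ := by
  refine ftrans_of _ _ ![(x₃) * x₁, x₂, x₃]
    ![(x₃)⁻¹ * x₁, x₂, x₃] ?_ ?_ ?_ ?_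
  · intro i; fin_cases i <;> simp <;> group
  · intro i; fin_cases i <;> simp <;> group
  · simp <;> group
  · simp <;> group

lemma ftrans_3_2 : FTrans (x₃) x₂ := by
  refine ftrans_of _ _ ![x₁, (x₃) * x₂, x₃]
    ![x₁, (x₃)⁻¹ * x₂, x₃] ?_ ?_ ?_ ?_
  · intro i; fin_cases i <;> simp <;> group
  · intro i; fin_cases i <;> simp <;> group
  · simp <;> group
  · simp <;> group

lemma ftrans_12_2 : FTrans (x₁ * x₂) x₂ := by
  refine ftrans_of _ _ ![(x₁ * x₂) * ((x₁ * x₂) * x₂)⁻¹, (x₁ * x₂) * x₂, x₃]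
    ![(x₁ * x₂) * ((x₁ * x₂)⁻¹ * x₂)⁻¹, (x₁ * x₂)⁻¹ * x₂, x₃] ?_ ?_ ?_ ?_
  · intro i; fin_cases i <;> simp <;> group
  · intro i; fin_cases i <;> simp <;> group
  · simp <;> group
  · simp <;> group

lemma ftrans_12_3 : FTrans (x₁ * x₂) x₃ := by
  refine ftrans_of _ _ ![x₁, x₂, (x₁ * x₂) * x₃]
    ![x₁, x₂, (x₁ * x₂)⁻¹ * x₃] ?_ ?_ ?_ ?_
  · intro i; fin_cases i <;> simp <;> group
  · intro i; fin_cases i <;> simp <;> group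
  · simp <;> group
  · simp <;> group

lemma ftrans_13_2 : FTrans (x₁ * x₃) x₂ := by
  refine ftrans_of _ _ ![x₁, (x₁ * x₃) * x₂, x₃]
    ![x₁, (x₁ * x₃)⁻¹ * x₂, x₃] ?_ ?_ ?_ ?_
  · intro i; fin_cases i <;> simp <;> group
  · intro i; fin_cases i <;> simp <;> group
  · simp <;> group
  · simp <;> group

lemma ftrans_13_3 : FTrans (x₁ * x₃) x₃ := by
  refine ftrans_of _ _ ![(x₁ * x₃) * ((x₁ * x₃) * x₃)⁻¹, x₂, (x₁ * x₃) * x₃]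
    ![(x₁ * x₃) * ((x₁ * x₃)⁻¹ * x₃)⁻¹, x₂, (x₁ * x₃)⁻¹ * x₃] ?_ ?_ ?_ ?_
  · intro i; fin_cases i <;> simp <;> group
  · intro i; fin_cases i <;> simp <;> group
  · simp <;> group
  · simp <;> group

lemma ftrans_23_1 : FTrans (x₂ * x₃) x₁ := by
  refine ftrans_of _ _ ![(x₂ * x₃) * x₁, x₂, x₃]
    ![(x₂ * x₃)⁻¹ * x₁, x₂, x₃] ?_ ?_ ?_ ?_
  · intro i; fin_cases i <;> simp <;> group
  · intro i; fin_cases i <;> simp <;> group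
  · simp <;> group
  · simp <;> group

lemma ftrans_23_3 : FTrans (x₂ * x₃) x₃ := by
  refine ftrans_of _ _ ![x₁, (x₂ * x₃) * ((x₂ * x₃) * x₃)⁻¹, (x₂ * x₃) * x₃]
    ![x₁, (x₂ * x₃) * ((x₂ * x₃)⁻¹ * x₃)⁻¹, (x₂ * x₃)⁻¹ * x₃] ?_ ?_ ?_ ?_
  · intro i; fin_cases i <;> simp <;> group
  · intro i; fin_cases i <;> simp <;> group
  · simp <;> group
  · simp <;> group

lemma ftrans_123_2 : FTrans (x₁ * x₂ * x₃) x₂ := by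
  refine ftrans_of _ _ ![(x₁ * x₂ * x₃) * (x₃)⁻¹ * ((x₁ * x₂ * x₃) * x₂)⁻¹, (x₁ * x₂ * x₃) * x₂, x₃]
    ![(x₁ * x₂ * x₃) * (x₃)⁻¹ * ((x₁ * x₂ * x₃)⁻¹ * x₂)⁻¹, (x₁ * x₂ * x₃)⁻¹ * x₂, x₃] ?_ ?_ ?_ ?_
  · intro i; fin_cases i <;> simp <;> group
  · intro i; fin_cases i <;> simp <;> group
  · simp <;> group
  · simp <;> group

lemma ftrans_123_3 : FTrans (x₁ * x₂ * x₃) x₃ := by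
  refine ftrans_of _ _ ![(x₁ * x₂ * x₃) * ((x₁ * x₂ * x₃) * x₃)⁻¹ * (x₂)⁻¹, x₂, (x₁ * x₂ * x₃) * x₃]
    ![(x₁ * x₂ * x₃) * ((x₁ * x₂ * x₃)⁻¹ * x₃)⁻¹ * (x₂)⁻¹, x₂, (x₁ * x₂ * x₃)⁻¹ * x₃] ?_ ?_ ?_ ?_
  · intro i; fin_cases i <;> simp <;> group
  · intro i; fin_cases i <;> simp <;> group
  · simp <;> group
  · simp <;> group

lemma coeM (B C : SL2C) : ((B * C : SL2C) : Matrix (Fin 2) (Fin 2) ℂ) =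
    (B : Matrix (Fin 2) (Fin 2) ℂ) * (C : Matrix (Fin 2) (Fin 2) ℂ) := rfl

lemma coeP (B : SL2C) (k : ℕ) : ((B ^ k : SL2C) : Matrix (Fin 2) (Fin 2) ℂ) =
    (B : Matrix (Fin 2) (Fin 2) ℂ) ^ k := Matrix.SpecialLinearGroup.coe_pow B k

lemma fin_of_trans {A₁ A₂ A₃ : SL2C} (hper : ElemPeriodic A₁ A₂ A₃)
    (u : FreeGroup (Fin 3)) (i : Fin 7) (h : FTrans u (w i)) :
    (Set.range fun k : ℕ => Matrix.trace
      (((rho A₁ A₂ A₃ u : Matrix (Fin 2) (Fin 2) ℂ)) ^ k *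
        (rho A₁ A₂ A₃ (w i) : Matrix (Fin 2) (Fin 2) ℂ))).Finite := by
  obtain ⟨α, h1, h2⟩ := h
  have hu : ∀ k : ℕ, (α ^ k) (w i) = u ^ k * w i := by
    intro k
    induction k with
    | zero => simp
    | succ k ih =>
      rw [pow_succ', MulAut.mul_apply, ih, map_mul, map_pow, h1, h2, pow_succ, mul_assoc]
  refine ((hper α).image (fun f => 2 * f i)).subset ?_
  rintro _ ⟨k, rfl⟩
  refine ⟨_, ⟨k, rfl⟩, ?_⟩
  simp only [chi, hu, map_mul, map_pow, coeM, coeP]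
  ring

def Eig (v : Fin 2 → ℂ) (l : ℂ) (B : SL2C) : Prop :=
  l ≠ 0 ∧ (B : Matrix (Fin 2) (Fin 2) ℂ) *ᵥ v = l • v

lemma Eig.mul {v l m B C} (h : Eig v l B) (h' : Eig v m C) : Eig v (l * m) (B * C) := by
  refine ⟨mul_ne_zero h.1 h'.1, ?_⟩
  rw [coeM, ← Matrix.mulVec_mulVec, h'.2, Matrix.mulVec_smul, h.2,
    smul_smul, mul_comm]

lemma Eig.one (v) : Eig v 1 1 := ⟨one_ne_zero, by simp⟩

lemma Eig.inv {v l B} (h : Eig v l B) : Eig v l⁻¹ B⁻¹ := by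
  refine ⟨inv_ne_zero h.1, ?_⟩
  have h2 : ((B⁻¹ * B : SL2C) : Matrix (Fin 2) (Fin 2) ℂ) *ᵥ v = v := by simp
  rw [coeM, ← Matrix.mulVec_mulVec, h.2, Matrix.mulVec_smul] at h2
  rw [← h2, smul_smul, inv_mul_cancel₀ h.1, one_smul, h2]

lemma Eig.pow {v l B} (h : Eig v l B) (k : ℕ) : Eig v (l ^ k) (B ^ k) := by
  induction k with
  | zero => simpa using Eig.one v
  | succ k ih => rw [pow_succ, pow_succ]; exact ih.mul h

lemma Eig.tr {v l B} (hv : v ≠ 0) (h : Eig v l B) :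
    Matrix.trace (B : Matrix (Fin 2) (Fin 2) ℂ) = l + l⁻¹ := by
  obtain ⟨hl, h⟩ := h
  have hd := B.det_coe
  rw [Matrix.det_fin_two] at hd
  have e0 := congrFun h 0
  have e1 := congrFun h 1
  simp only [Matrix.mulVec, dotProduct, Fin.sum_univ_two, Pi.smul_apply, smul_eq_mul] at e0 e1
  rw [Matrix.trace_fin_two]
  set a := (B : Matrix (Fin 2) (Fin 2) ℂ) 0 0
  set b := (B : Matrix (Fin 2) (Fin 2) ℂ) 0 1
  set c := (B : Matrix (Fin 2) (Fin 2) ℂ) 1 0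
  set d := (B : Matrix (Fin 2) (Fin 2) ℂ) 1 1
  have key : l * (a + d) = l ^ 2 + 1 := by
    by_cases h0 : v 0 = 0
    · have h1 : v 1 ≠ 0 := by
        intro h1; apply hv; ext i; fin_cases i <;> simp [h0, h1]
      apply mul_left_cancel₀ h1
      linear_combination (c) * e0 + (l - a) * e1 + v 1 * hd
    · apply mul_left_cancel₀ h0
      linear_combination (b) * e1 + (l - d) * e0 + v 0 * hd
  field_simp
  linear_combination key

lemma finite_inv (s : Set ℂ) (hs : s.Finite) : {z : ℂ | z ≠ 0 ∧ z + z⁻¹ ∈ s}.Finite := by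
  have : {z : ℂ | z ≠ 0 ∧ z + z⁻¹ ∈ s} ⊆ ⋃ c ∈ s, {z : ℂ | z ≠ 0 ∧ z + z⁻¹ = c} := by
    intro z hz
    simpa using hz
  refine (hs.biUnion ?_).subset this
  intro c _
  rcases Set.eq_empty_or_nonempty {z : ℂ | z ≠ 0 ∧ z + z⁻¹ = c} with h | ⟨z0, h0, h1⟩
  · rw [h]; exact Set.finite_empty
  · refine (Set.toFinite {z0, z0⁻¹}).subset ?_
    rintro z ⟨hz, hz1⟩
    have : (z - z0) * (z - z0⁻¹) = 0 := by
      have e : z + z⁻¹ = z0 + z0⁻¹ := hz1.trans h1.symm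
      field_simp at e ⊢
      linear_combination e
    rcases mul_eq_zero.mp this with h | h
    · left; exact sub_eq_zero.mp h
    · right; exact sub_eq_zero.mp h

lemma norm_one {v l m} {B C : SL2C} (hv : v ≠ 0) (hB : Eig v l B) (hC : Eig v m C)
    (hf : (Set.range fun k : ℕ => Matrix.trace ((B : Matrix (Fin 2) (Fin 2) ℂ) ^ k *
      (C : Matrix (Fin 2) (Fin 2) ℂ))).Finite) : ‖l‖ = 1 := by
  have h1 : (Set.range fun k : ℕ => l ^ k * m).Finite := by
    refine (finite_inv _ hf).subset ?_
    rintro _ ⟨k, rfl⟩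
    have h := (hB.pow k).mul hC
    refine ⟨h.1, k, ?_⟩
    have := h.tr hv
    simpa using this
  by_contra hne
  have hinj : Function.Injective fun k : ℕ => l ^ k * m := by
    intro a b hab
    have h2 : l ^ a = l ^ b := mul_right_cancel₀ hC.1 hab
    have h3 : ‖l‖ ^ a = ‖l‖ ^ b := by rw [← norm_pow, h2, norm_pow]
    exact pow_right_injective₀ (norm_pos_iff.mpr hB.1) hne h3
  exact Set.infinite_range_of_injective hinj h1

lemma parabolic (U : SL2C)
    (ht : Matrix.trace (U : Matrix (Fin 2) (Fin 2) ℂ) = 2 ∨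
      Matrix.trace (U : Matrix (Fin 2) (Fin 2) ℂ) = -2)
    (h1 : (U : Matrix (Fin 2) (Fin 2) ℂ) ≠ 1) (h2 : (U : Matrix (Fin 2) (Fin 2) ℂ) ≠ -1) :
    ∃ v : Fin 2 → ℂ, v ≠ 0 ∧ (∃ l, Eig v l U) ∧ ∀ B : SL2C,
      (Set.range fun k : ℕ => Matrix.trace ((U : Matrix (Fin 2) (Fin 2) ℂ) ^ k *
      (B : Matrix (Fin 2) (Fin 2) ℂ))).Finite → ∃ l, Eig v l B := by
  obtain ⟨e, he, het, hne⟩ : ∃ e : ℂ, e ^ 2 = 1 ∧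
      Matrix.trace (U : Matrix (Fin 2) (Fin 2) ℂ) = 2 * e ∧
      (U : Matrix (Fin 2) (Fin 2) ℂ) ≠ e • 1 := by
    rcases ht with h | h
    · exact ⟨1, by norm_num, by rw [h]; norm_num, by simpa using h1⟩
    · exact ⟨-1, by norm_num, by rw [h]; norm_num, by simpa using h2⟩
  have hd := U.det_coe
  rw [Matrix.det_fin_two] at hd
  rw [Matrix.trace_fin_two] at het
  set M := (U : Matrix (Fin 2) (Fin 2) ℂ) with hM
  obtain ⟨p, hp⟩ : ∃ p, p = M 0 0 - e := ⟨_, rfl⟩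
  obtain ⟨q, hq⟩ : ∃ q, q = M 0 1 := ⟨_, rfl⟩
  obtain ⟨r, hr⟩ : ∃ r, r = M 1 0 := ⟨_, rfl⟩
  have hs : M 1 1 = e - p := by linear_combination het + hp
  have hp' : M 0 0 = e + p := by rw [hp]; ring
  rw [hp', hs, ← hq, ← hr] at hd
  have hdet : p ^ 2 + q * r = 0 := by linear_combination he - hd
  have hMe : M = !![e + p, q; r, e - p] := by
    ext i j; fin_cases i <;> fin_cases j <;> simp [hp', hs, hq, hr]
  have he0 : e ≠ 0 := by rintro rfl; norm_num at he
  have hpow : ∀ k : ℕ, M ^ (2 * k) = !![1 + 2 * k * e * p, 2 * k * e * q;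
      2 * k * e * r, 1 - 2 * k * e * p] := by
    intro k
    induction k with
    | zero => ext i j; fin_cases i <;> fin_cases j <;> simp
    | succ k ih =>
      rw [mul_add, pow_add, ih, hMe]
      ext i j; fin_cases i <;> fin_cases j <;>
        simp [pow_two, Matrix.mul_apply, Fin.sum_univ_two]
      · linear_combination (1 + 2 * k * e * p) * he + (1 + 2 * k * e * p + 4 * k * e ^ 2) * hdet
      · linear_combination (2 * k * e * q) * he + (2 * k * e * q) * hdet
      · linear_combination (2 * k * e * r) * he + (2 * k * e * r) * hdet
      · linear_combination (1 - 2 * k * e * p) * he + (1 - 2 * k * e * p + 4 * k * e ^ 2) * hdet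
  have hlin : ∀ B : SL2C, (Set.range fun k : ℕ => Matrix.trace (M ^ k *
      (B : Matrix (Fin 2) (Fin 2) ℂ))).Finite →
      p * B 0 0 + q * B 1 0 + r * B 0 1 - p * B 1 1 = 0 := by
    intro B hf
    by_contra hc
    have hinj : Function.Injective fun k : ℕ => Matrix.trace (M ^ (2 * k) *
        (B : Matrix (Fin 2) (Fin 2) ℂ)) := by
      intro a b hab
      simp only [hpow, Matrix.trace_fin_two, Matrix.mul_apply, Fin.sum_univ_two] at hab
      simp at hab
      have : (2 * e * (p * B 0 0 + q * B 1 0 + r * B 0 1 - p * B 1 1)) * ((a : ℂ) - b) = 0 := by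
        linear_combination hab
      rcases mul_eq_zero.mp this with h | h
      · exact absurd h (mul_ne_zero (mul_ne_zero two_ne_zero he0) hc)
      · exact_mod_cast sub_eq_zero.mp h
    refine Set.infinite_range_of_injective hinj (hf.subset ?_)
    rintro _ ⟨k, rfl⟩
    exact ⟨2 * k, rfl⟩
  have mk : ∀ (v : Fin 2 → ℂ) (B : SL2C), v ≠ 0 →
      v 0 * (B 1 0 * v 0 + B 1 1 * v 1) = v 1 * (B 0 0 * v 0 + B 0 1 * v 1) →
      ∃ l, Eig v l B := by
    intro v B hv h
    obtain ⟨l, hl⟩ : ∃ l : ℂ, (B : Matrix (Fin 2) (Fin 2) ℂ) *ᵥ v = l • v := by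
      by_cases h0 : v 0 = 0
      · have h1 : v 1 ≠ 0 := by
          intro h1; apply hv; ext i; fin_cases i <;> simp [h0, h1]
        refine ⟨(B 1 0 * v 0 + B 1 1 * v 1) / v 1, ?_⟩
        ext i; fin_cases i <;> simp [Matrix.mulVec, dotProduct, Fin.sum_univ_two]
        · field_simp; linear_combination -h
        · field_simp
      · refine ⟨(B 0 0 * v 0 + B 0 1 * v 1) / v 0, ?_⟩
        ext i; fin_cases i <;> simp [Matrix.mulVec, dotProduct, Fin.sum_univ_two]
        · field_simp
        · field_simp; linear_combination h
    refine ⟨l, ?_, hl⟩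
    rintro rfl
    apply hv
    have h2 : ((B⁻¹ * B : SL2C) : Matrix (Fin 2) (Fin 2) ℂ) *ᵥ v = v := by simp
    rw [coeM, ← Matrix.mulVec_mulVec, hl] at h2
    simpa using h2.symm
  by_cases hr0 : r = 0
  · have hp0 : p = 0 := by simpa [hr0] using hdet
    have hq0 : q ≠ 0 := by
      rintro hq0
      apply hne
      rw [hMe, hr0, hp0, hq0]
      ext i j; fin_cases i <;> fin_cases j <;> simp
    have hv : (![1, 0] : Fin 2 → ℂ) ≠ 0 := by
      intro h; simpa using congrFun h 0
    refine ⟨![1, 0], hv, mk _ _ hv ?_, fun B hB => mk _ _ hv ?_⟩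
    · have : U 1 0 = 0 := by rw [← hr0, hr]
      simp [this]
    · have := hlin B hB
      simpa [hr0, hp0, hq0] using this
  · have hv : (![p, r] : Fin 2 → ℂ) ≠ 0 := by
      intro h; exact hr0 (by simpa using congrFun h 1)
    refine ⟨![p, r], hv, mk _ _ hv ?_, fun B hB => mk _ _ hv ?_⟩
    · have a1 : U 0 0 = e + p := hp'
      have a2 : U 0 1 = q := hq.symm
      have a3 : U 1 0 = r := hr.symm
      have a4 : U 1 1 = e - p := hs
      simp [a1, a2, a3, a4]
      linear_combination (-r) * hdet
    · have := hlin B hB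
      simp
      linear_combination (-r) * this + B 1 0 * hdet

lemma exists_t (l : ℂ) (h : ‖l‖ = 1) : ∃ t : ℝ, l = Complex.exp ((2 * π * t : ℝ) * Complex.I) := by
  refine ⟨l.arg / (2 * π), ?_⟩
  have h2 : 2 * π * (l.arg / (2 * π)) = l.arg := by field_simp
  rw [h2]
  have := Complex.norm_mul_exp_arg_mul_I l
  rw [h] at this
  simpa using this.symm

lemma half_cos (x : ℝ) : (Complex.exp (x * Complex.I) + (Complex.exp (x * Complex.I))⁻¹) / 2 =
    ((Real.cos x : ℝ) : ℂ) := by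
  rw [Complex.ofReal_cos, Complex.cos, ← Complex.exp_neg]
  congr 3
  ring

lemma common {A₁ A₂ A₃ : SL2C} (hper : ElemPeriodic A₁ A₂ A₃) (i : Fin 7)
    (ht : Matrix.trace ((rho A₁ A₂ A₃ (w i) : Matrix (Fin 2) (Fin 2) ℂ)) = 2 ∨
       Matrix.trace ((rho A₁ A₂ A₃ (w i) : Matrix (Fin 2) (Fin 2) ℂ)) = -2)
    (h1 : (rho A₁ A₂ A₃ (w i) : Matrix (Fin 2) (Fin 2) ℂ) ≠ 1)
    (h2 : (rho A₁ A₂ A₃ (w i) : Matrix (Fin 2) (Fin 2) ℂ) ≠ -1) :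
    ∃ v : Fin 2 → ℂ, v ≠ 0 ∧ (∃ l, Eig v l A₁) ∧ (∃ l, Eig v l A₂) ∧ (∃ l, Eig v l A₃) := by
  obtain ⟨v, hv, ⟨u, hu⟩, H⟩ := parabolic _ ht h1 h2
  have T : ∀ j, FTrans (w i) (w j) → ∃ l, Eig v l (rho A₁ A₂ A₃ (w j)) :=
    fun j hj => H _ (fin_of_trans hper _ _ hj)
  have r1 : rho A₁ A₂ A₃ (w 0) = A₁ := by simp [rho, w]
  have r2 : rho A₁ A₂ A₃ (w 1) = A₂ := by simp [rho, w]
  have r3 : rho A₁ A₂ A₃ (w 2) = A₃ := by simp [rho, w]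
  have T1 := T 0
  have T2 := T 1
  have T3 := T 2
  rw [r1] at T1
  rw [r2] at T2
  rw [r3] at T3
  refine ⟨v, hv, ?_⟩
  fin_cases i
  · have hu' : Eig v u A₁ := by simpa [rho, w] using hu
    exact ⟨⟨u, hu'⟩, T2 ftrans_1_2, T3 ftrans_1_3⟩
  · have hu' : Eig v u A₂ := by simpa [rho, w] using hu
    exact ⟨T1 ftrans_2_1, ⟨u, hu'⟩, T3 ftrans_2_3⟩
  · have hu' : Eig v u A₃ := by simpa [rho, w] using hu
    exact ⟨T1 ftrans_3_1, T2 ftrans_3_2, ⟨u, hu'⟩⟩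
  · have hu' : Eig v u (A₁ * A₂) := by simpa [rho, w] using hu
    obtain ⟨m, hm⟩ := T2 ftrans_12_2
    exact ⟨⟨_, by simpa using hu'.mul hm.inv⟩, ⟨m, hm⟩, T3 ftrans_12_3⟩
  · have hu' : Eig v u (A₁ * A₃) := by simpa [rho, w] using hu
    obtain ⟨m, hm⟩ := T3 ftrans_13_3
    exact ⟨⟨_, by simpa using hu'.mul hm.inv⟩, T2 ftrans_13_2, ⟨m, hm⟩⟩
  · have hu' : Eig v u (A₂ * A₃) := by simpa [rho, w] using hu
    obtain ⟨m, hm⟩ := T3 ftrans_23_3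
    exact ⟨T1 ftrans_23_1, ⟨_, by simpa using hu'.mul hm.inv⟩, ⟨m, hm⟩⟩
  · have hu' : Eig v u (A₁ * A₂ * A₃) := by simpa [rho, w] using hu
    obtain ⟨m, hm⟩ := T3 ftrans_123_3
    obtain ⟨n, hn⟩ := T2 ftrans_123_2
    exact ⟨⟨_, by simpa using (hu'.mul hm.inv).mul hn.inv⟩, ⟨n, hn⟩, ⟨m, hm⟩⟩

theorem stmt14 (A₁ A₂ A₃ : SL2C)
    (htr : ∀ i : Fin 7, (chi A₁ A₂ A₃ 1 i).im = 0)
    (hper : ElemPeriodic A₁ A₂ A₃)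
    (hpar : ∃ i : Fin 7,
      (Matrix.trace ((rho A₁ A₂ A₃ (w i) : Matrix (Fin 2) (Fin 2) ℂ)) = 2 ∨
       Matrix.trace ((rho A₁ A₂ A₃ (w i) : Matrix (Fin 2) (Fin 2) ℂ)) = -2) ∧
      (rho A₁ A₂ A₃ (w i) : Matrix (Fin 2) (Fin 2) ℂ) ≠ 1 ∧
      (rho A₁ A₂ A₃ (w i) : Matrix (Fin 2) (Fin 2) ℂ) ≠ -1) :
    ∃ t₁ t₂ t₃ : ℝ, ∀ i : Fin 7, chi A₁ A₂ A₃ 1 i = (Pi3 t₁ t₂ t₃ i : ℂ) := by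
  obtain ⟨i, ht, h1, h2⟩ := hpar
  obtain ⟨v, hv, ⟨l₁, e₁⟩, ⟨l₂, e₂⟩, ⟨l₃, e₃⟩⟩ := common hper i ht h1 h2
  have n₁ : ‖l₁‖ = 1 := norm_one hv e₁ e₂
    (by simpa [rho, w] using fin_of_trans hper (w 0) 1 ftrans_1_2)
  have n₂ : ‖l₂‖ = 1 := norm_one hv e₂ e₁
    (by simpa [rho, w] using fin_of_trans hper (w 1) 0 ftrans_2_1)
  have n₃ : ‖l₃‖ = 1 := norm_one hv e₃ e₁
    (by simpa [rho, w] using fin_of_trans hper (w 2) 0 ftrans_3_1)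
  obtain ⟨t₁, rfl⟩ := exists_t _ n₁
  obtain ⟨t₂, rfl⟩ := exists_t _ n₂
  obtain ⟨t₃, rfl⟩ := exists_t _ n₃
  refine ⟨t₁, t₂, t₃, ?_⟩
  have key : ∀ (B : SL2C) (x : ℝ), Eig v (Complex.exp (x * Complex.I)) B →
      Matrix.trace (B : Matrix (Fin 2) (Fin 2) ℂ) / 2 = ((Real.cos x : ℝ) : ℂ) := by
    intro B x hB
    rw [hB.tr hv, half_cos]
  have mulE : ∀ (B C : SL2C) (x y : ℝ), Eig v (Complex.exp ((2 * π * x : ℝ) * Complex.I)) B →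
      Eig v (Complex.exp ((2 * π * y : ℝ) * Complex.I)) C →
      Eig v (Complex.exp ((2 * π * (x + y) : ℝ) * Complex.I)) (B * C) := by
    intro B C x y hB hC
    have := hB.mul hC
    rw [← Complex.exp_add, ← add_mul, ← Complex.ofReal_add, ← mul_add] at this
    exact this
  have c0 := key _ _ e₁
  have c1 := key _ _ e₂
  have c2 := key _ _ e₃
  have c3 := key _ _ (mulE _ _ _ _ e₁ e₂)
  have c4 := key _ _ (mulE _ _ _ _ e₁ e₃)
  have c5 := key _ _ (mulE _ _ _ _ e₂ e₃)
  have c6 := key _ _ (mulE _ _ _ _ (mulE _ _ _ _ e₁ e₂) e₃)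
  have E : ∀ i, chi A₁ A₂ A₃ 1 i =
      Matrix.trace ((![A₁, A₂, A₃, A₁ * A₂, A₁ * A₃, A₂ * A₃, A₁ * A₂ * A₃] i : SL2C) :
        Matrix (Fin 2) (Fin 2) ℂ) / 2 := by
    intro i
    fin_cases i <;> simp [chi, rho, w]
  intro i
  rw [E]
  fin_cases i
  · exact c0
  · exact c1
  · exact c2
  · exact c3
  · exact c4
  · exact c5
  · exact c6


end
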